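/- arXiv:2412.20198 — 2 statements merged into one kernel-verified Lean document; each statement's English description precedes it below -/
import Mathlib

section
/- Let 2 ≤ k, let f₀ : (0,1) → ℝ be such that s ↦ f₀(s)(1-s²)^{(k-3)/2} s is integrable on (t,1). Then for 0 < ρ < 1 and x ∈ ℝⁿ with |x| = 1-ρ, the average over the unit sphere S^{k-1} of f₀(|x + ρθ|) equals (σ_{k-2}/σ_{k-1}) ∫_{|1-2ρ|}^1 f₀(s) (1-s²)^{(k-3)/2} (s² - (1-2ρ)²)^{(k-3)/2} (2ρ(1-ρ))^{3-k} · s/(ρ(1-ρ)) ds, where σ_{m-1} = 2π^{m/2}/Γ(m/2) is the surface area of S^{m-1}. -/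
open MeasureTheory Set

lemma aux_polar (n : ℕ) (F : EuclideanSpace ℝ (Fin (n+1)) → ENNReal) (hF : Measurable F) :
    ∫⁻ x, F x = ∫⁻ θ : Metric.sphere (0 : EuclideanSpace ℝ (Fin (n+1))) 1,
      (∫⁻ r in Ioi (0:ℝ), ENNReal.ofReal (r ^ n) * F (r • θ.1))
      ∂((volume : Measure (EuclideanSpace ℝ (Fin (n+1)))).toSphere) := by
  have hd : Module.finrank ℝ (EuclideanSpace ℝ (Fin (n+1))) - 1 = n := by simp
  have hmp := (volume : Measure (EuclideanSpace ℝ (Fin (n+1)))).measurePreserving_homeomorphUnitSphereProd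
  rw [hd] at hmp
  have h1 : ∫⁻ x, F x = ∫⁻ x : ({(0)}ᶜ : Set (EuclideanSpace ℝ (Fin (n+1)))), F x.1 ∂((volume : Measure (EuclideanSpace ℝ (Fin (n+1)))).comap (↑)) := by
    rw [lintegral_subtype_comap (measurableSet_singleton _).compl, restrict_compl_singleton]
  rw [h1]
  have h2 := hmp.lintegral_comp_emb (Homeomorph.measurableEmbedding _)
    (fun p => F (p.2.1 • p.1.1))
  have h3 : ∀ x : ({(0)}ᶜ : Set (EuclideanSpace ℝ (Fin (n+1)))), ((homeomorphUnitSphereProd (EuclideanSpace ℝ (Fin (n+1))) x).2 : ℝ) •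
      ((homeomorphUnitSphereProd (EuclideanSpace ℝ (Fin (n+1))) x).1 : (EuclideanSpace ℝ (Fin (n+1)))) = x.1 := by
    intro x
    have := (homeomorphUnitSphereProd (EuclideanSpace ℝ (Fin (n+1)))).symm_apply_apply x
    rw [← homeomorphUnitSphereProd_symm_apply_coe, this]
  simp only [h3] at h2
  rw [h2, lintegral_prod]
  · refine lintegral_congr fun θ => ?_
    unfold Measure.volumeIoiPow
    rw [lintegral_withDensity_eq_lintegral_mul₀]
    · rw [← lintegral_subtype_comap measurableSet_Ioi]
      rfl
    · fun_prop
    · apply Measurable.aemeasurable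
      fun_prop
  · apply Measurable.aemeasurable
    fun_prop

lemma aux_split (n : ℕ) (F : ℝ → ℝ → ENNReal) (hF : Measurable (Function.uncurry F))
    (e : EuclideanSpace ℝ (Fin (n+1))) (he : ‖e‖ = 1) :
    ∫⁻ x, F (inner ℝ e x) ‖x‖ = ∫⁻ u : ℝ, ∫⁻ y : EuclideanSpace ℝ (Fin n),
      F u (√(u^2 + ‖y‖^2)) := by
  obtain ⟨b, hb⟩ : ∃ b : OrthonormalBasis (Fin (n+1)) ℝ (EuclideanSpace ℝ (Fin (n+1))),
      b 0 = e := by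
    have := Orthonormal.exists_orthonormalBasis_extension_of_card_eq (𝕜 := ℝ)
      (E := EuclideanSpace ℝ (Fin (n+1))) (ι := Fin (n+1)) (by simp) (v := fun _ => e) (s := {0})
      (by
        constructor
        · intro i; simpa using he
        · intro i j hij
          exact absurd (Subsingleton.elim i j) hij)
    obtain ⟨b, hb⟩ := this
    exact ⟨b, hb 0 rfl⟩
  have h1 : ∀ x, F (inner ℝ e x) ‖x‖ = (fun y : EuclideanSpace ℝ (Fin (n+1)) => F (y 0) ‖y‖) (b.repr x) := by
    intro x
    simp [b.repr_apply_apply, hb]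
  rw [lintegral_congr h1]
  rw [b.measurePreserving_repr.lintegral_comp_emb (b.repr.toHomeomorph.measurableEmbedding)
    (fun y : EuclideanSpace ℝ (Fin (n+1)) => F (y 0) ‖y‖)]
  rw [← (PiLp.volume_preserving_toLp (Fin (n+1))).lintegral_comp_emb
    (MeasurableEquiv.toLp 2 (Fin (n+1) → ℝ)).measurableEmbedding]
  rw [← (volume_preserving_piFinSuccAbove (fun _ : Fin (n+1) => ℝ) 0).symm.lintegral_comp_emb
    (MeasurableEquiv.measurableEmbedding _)]
  rw [Measure.volume_eq_prod, lintegral_prod]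
  · refine lintegral_congr fun u => ?_
    rw [← (PiLp.volume_preserving_toLp (Fin n)).lintegral_comp_emb
      (MeasurableEquiv.toLp 2 (Fin n → ℝ)).measurableEmbedding]
    refine lintegral_congr fun y => ?_
    simp [EuclideanSpace.norm_eq, Fin.sum_univ_succ, Real.sq_sqrt, Finset.sum_nonneg, sq_nonneg,
      MeasurableEquiv.piFinSuccAbove]
  · apply Measurable.aemeasurable
    have : Measurable fun y : EuclideanSpace ℝ (Fin (n+1)) => F (y 0) ‖y‖ :=
      hF.comp (f := fun y : EuclideanSpace ℝ (Fin (n+1)) => (y 0, ‖y‖)) (by fun_prop)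
    exact this.comp ((PiLp.volume_preserving_toLp (Fin (n+1))).measurable.comp
      (MeasurableEquiv.measurable _))

lemma aux_norm (n : ℕ) (g : ℝ → ENNReal) (hg : Measurable g) :
    ∫⁻ x : EuclideanSpace ℝ (Fin (n+1)), g ‖x‖ =
     (volume : Measure (EuclideanSpace ℝ (Fin (n+1)))).toSphere univ *
      ∫⁻ r in Ioi (0:ℝ), ENNReal.ofReal (r ^ n) * g r := by
  rw [aux_polar n _ (by fun_prop), mul_comm, ← lintegral_const]
  refine lintegral_congr fun θ => setLIntegral_congr_fun measurableSet_Ioi fun r hr => ?_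
  simp [norm_smul, abs_of_pos (mem_Ioi.1 hr)]

lemma aux_sigma (n : ℕ) : (volume : Measure (EuclideanSpace ℝ (Fin (n+1)))).toSphere univ =
    ENNReal.ofReal (2 * Real.pi ^ (((n+1 : ℕ) : ℝ) / 2) / Real.Gamma (((n+1 : ℕ) : ℝ) / 2)) := by
  have hn : (0:ℝ) < ((n+1 : ℕ) : ℝ) / 2 := by positivity
  rw [Measure.toSphere_apply_univ, EuclideanSpace.volume_ball, Real.Gamma_add_one (by simpa using hn.ne')]
  have hG := Real.Gamma_pos_of_pos hn
  rw [Real.sqrt_eq_rpow, ← Real.rpow_natCast, ← Real.rpow_mul Real.pi_pos.le]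
  simp only [finrank_euclideanSpace, Fintype.card_fin, ENNReal.ofReal_one, one_pow, one_mul]
  rw [← ENNReal.ofReal_natCast, ← ENNReal.ofReal_mul (by positivity)]
  congr 1
  rw [show (1:ℝ) / 2 * ((n+1 : ℕ) : ℝ) = ((n+1 : ℕ) : ℝ) / 2 by ring]
  field_simp

lemma aux_slice (m : ℕ) (F : ℝ → ENNReal) (hF : Measurable F)
    (e : EuclideanSpace ℝ (Fin (m+2))) (he : ‖e‖ = 1) :
    ∫⁻ θ : Metric.sphere (0 : EuclideanSpace ℝ (Fin (m+2))) 1, F (inner ℝ e θ.1)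
      ∂((volume : Measure (EuclideanSpace ℝ (Fin (m+2)))).toSphere) =
    (volume : Measure (EuclideanSpace ℝ (Fin (m+1)))).toSphere univ *
      ∫⁻ φ in Ioo 0 Real.pi, ENNReal.ofReal (Real.sin φ ^ m) * F (Real.cos φ) := by
  set g : ℝ → ENNReal := (Iio (1:ℝ)).indicator 1 with hg
  have hgm : Measurable g := measurable_one.indicator measurableSet_Iio
  set C : ENNReal := ∫⁻ r in Ioi (0:ℝ), ENNReal.ofReal (r ^ (m+1)) * g r with hC
  have hCC : Measure.volumeIoiPow (m+1) (Iio ⟨1, mem_Ioi.2 one_pos⟩) = C := by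
    rw [← lintegral_indicator_one measurableSet_Iio]
    unfold Measure.volumeIoiPow
    rw [lintegral_withDensity_eq_lintegral_mul₀]
    · rw [hC, ← lintegral_subtype_comap measurableSet_Ioi]
      refine lintegral_congr fun r => ?_
      simp [hg, indicator, ← Subtype.coe_lt_coe]
    · fun_prop
    · exact (measurable_one.indicator measurableSet_Iio).aemeasurable
  rw [Measure.volumeIoiPow_apply_Iio] at hCC
  have hC0 : C ≠ 0 := by
    rw [← hCC]; simp; positivity
  have hCt : C ≠ ⊤ := by
    rw [← hCC]; simp
  have hA : ∫⁻ x : EuclideanSpace ℝ (Fin (m+2)), F (inner ℝ e x / ‖x‖) * g ‖x‖ =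
     (∫⁻ θ : Metric.sphere (0 : EuclideanSpace ℝ (Fin (m+2))) 1, F (inner ℝ e θ.1)
      ∂((volume : Measure (EuclideanSpace ℝ (Fin (m+2)))).toSphere)) * C := by
    rw [aux_polar (m+1) _ (by fun_prop), ← lintegral_mul_const _ (by fun_prop)]
    refine lintegral_congr fun θ => ?_
    rw [hC, ← lintegral_const_mul _ (by fun_prop)]
    refine setLIntegral_congr_fun measurableSet_Ioi fun r hr => ?_
    have hr' : 0 < r := hr
    have : r * inner ℝ e θ.1 / r = inner ℝ e θ.1 := by field_simp
    simp only [norm_smul, Real.norm_eq_abs, abs_of_pos hr', norm_eq_of_mem_sphere, mul_one,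
      inner_smul_right, this]
    ring
  have hFu : Measurable (Function.uncurry fun u r : ℝ => F (u / r) * g r) := by
    unfold Function.uncurry; fun_prop
  rw [aux_split (m+1) (fun u r => F (u / r) * g r) hFu e he] at hA
  have hB : ∀ u : ℝ, ∫⁻ y : EuclideanSpace ℝ (Fin (m+1)), F (u / √(u^2 + ‖y‖^2)) * g (√(u^2 + ‖y‖^2))
     = (volume : Measure (EuclideanSpace ℝ (Fin (m+1)))).toSphere univ * ∫⁻ r in Ioi (0:ℝ),
       ENNReal.ofReal (r ^ m) * (F (u / √(u^2 + r^2)) * g (√(u^2 + r^2))) := fun u =>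
    aux_norm m (fun r => F (u / √(u^2 + r^2)) * g (√(u^2 + r^2))) (by fun_prop)
  simp_rw [hB] at hA
  set σ := (volume : Measure (EuclideanSpace ℝ (Fin (m+1)))).toSphere univ with hσ
  set K : ℝ × ℝ → ENNReal := fun p => (Ioi (0:ℝ)).indicator (fun r => ENNReal.ofReal (r ^ m)) p.2
    * (F (p.1 / √(p.1^2 + p.2^2)) * g (√(p.1^2 + p.2^2))) with hK
  have hind : Measurable ((Ioi (0:ℝ)).indicator (fun r => ENNReal.ofReal (r ^ m))) :=
    Measurable.indicator (by fun_prop) measurableSet_Ioi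
  have hKm : Measurable K := by fun_prop
  have hD : ∫⁻ u : ℝ, ∫⁻ r in Ioi (0:ℝ),
       ENNReal.ofReal (r ^ m) * (F (u / √(u^2 + r^2)) * g (√(u^2 + r^2))) = ∫⁻ p, K p := by
    rw [Measure.volume_eq_prod, lintegral_prod _ hKm.aemeasurable]
    refine lintegral_congr fun u => ?_
    rw [← lintegral_indicator measurableSet_Ioi]
    refine lintegral_congr fun r => ?_
    by_cases hr : r ∈ Ioi (0:ℝ) <;> simp [hK, hr]
  have hin : ∀ u : ℝ, Measurable fun r : ℝ => ENNReal.ofReal (r ^ m) * (F (u / √(u^2 + r^2)) * g (√(u^2 + r^2))) := by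
    intro u; fun_prop
  rw [lintegral_const_mul, hD, ← lintegral_comp_polarCoord_symm] at hA
  swap
  · apply Measurable.lintegral_prod_right' (f := fun p : ℝ × ℝ => ENNReal.ofReal (p.2 ^ m) * (F (p.1 / √(p.1^2 + p.2^2)) * g (√(p.1^2 + p.2^2))))
    fun_prop
  have hE : ∫⁻ (p : ℝ × ℝ) in polarCoord.target, ENNReal.ofReal p.1 • K (polarCoord.symm p) =
      C * ∫⁻ φ in Ioo 0 Real.pi, ENNReal.ofReal (Real.sin φ ^ m) * F (Real.cos φ) := by
    have h1 : ∀ p ∈ polarCoord.target, ENNReal.ofReal p.1 • K (polarCoord.symm p) =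
       (ENNReal.ofReal (p.1 ^ (m+1)) * g p.1) * (Ioo 0 Real.pi).indicator
         (fun φ => ENNReal.ofReal (Real.sin φ ^ m) * F (Real.cos φ)) p.2 := by
      rintro ⟨r, φ⟩ ⟨hr, hφ⟩
      have hr' : 0 < r := hr
      simp only at hr hφ
      have hs : √((r * Real.cos φ)^2 + (r * Real.sin φ)^2) = r := by
        rw [show (r * Real.cos φ)^2 + (r * Real.sin φ)^2 = r^2 * (Real.sin φ^2 + Real.cos φ^2) by ring,
          Real.sin_sq_add_cos_sq, mul_one, Real.sqrt_sq hr'.le]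
      have hc : r * Real.cos φ / r = Real.cos φ := by field_simp
      simp only [hK, polarCoord_symm_apply, hs, hc, smul_eq_mul]
      by_cases hp : 0 < φ
      · have hsin : 0 < Real.sin φ := Real.sin_pos_of_pos_of_lt_pi hp hφ.2
        rw [indicator_of_mem (show r * Real.sin φ ∈ Ioi (0:ℝ) from mul_pos hr' hsin),
          indicator_of_mem (show φ ∈ Ioo 0 Real.pi from ⟨hp, hφ.2⟩), mul_pow,
          ENNReal.ofReal_mul (by positivity), pow_succ, ENNReal.ofReal_mul (by positivity)]
        ring
      · have hsin : Real.sin φ ≤ 0 := Real.sin_nonpos_of_nonpos_of_neg_pi_le (not_lt.1 hp) hφ.1.le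
        rw [indicator_of_notMem (show r * Real.sin φ ∉ Ioi (0:ℝ) from
            not_lt.2 (mul_nonpos_of_nonneg_of_nonpos hr'.le hsin)),
          indicator_of_notMem (show φ ∉ Ioo 0 Real.pi from fun h => hp h.1)]
        simp
    rw [setLIntegral_congr_fun polarCoord.open_target.measurableSet h1, polarCoord_target,
      Measure.volume_eq_prod, ← Measure.prod_restrict,
      lintegral_prod_mul (f := fun r => ENNReal.ofReal (r ^ (m+1)) * g r) (g := (Ioo 0 Real.pi).indicator
         (fun φ => ENNReal.ofReal (Real.sin φ ^ m) * F (Real.cos φ))) (by fun_prop)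
         (Measurable.indicator (by fun_prop) measurableSet_Ioo).aemeasurable,
      setLIntegral_indicator measurableSet_Ioo]
    have : Ioo 0 Real.pi ∩ Ioo (-Real.pi) Real.pi = Ioo 0 Real.pi :=
      inter_eq_left.2 (Ioo_subset_Ioo_left (by linarith [Real.pi_pos]))
    rw [this]
  rw [hE, mul_left_comm, mul_comm _ C] at hA
  exact ((ENNReal.mul_right_inj hC0 hCt).1 hA).symm

lemma aux_slice' (m : ℕ) (F : ℝ → ENNReal) :
      ∫⁻ φ in Ioo 0 Real.pi, ENNReal.ofReal (Real.sin φ ^ m) * F (Real.cos φ) =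
      ∫⁻ t in Ioo (-1:ℝ) 1, ENNReal.ofReal ((1 - t^2) ^ (((m:ℝ) - 1)/2)) * F t := by
  have him : Real.cos '' Ioo 0 Real.pi = Ioo (-1) 1 := by
    ext t
    constructor
    · rintro ⟨φ, hφ, rfl⟩
      have hs := Real.sin_pos_of_pos_of_lt_pi hφ.1 hφ.2
      constructor <;> nlinarith [Real.sin_sq_add_cos_sq φ]
    · rintro ⟨h1, h2⟩
      refine ⟨Real.arccos t, ⟨Real.arccos_pos.2 h2, ?_⟩, Real.cos_arccos h1.le h2.le⟩
      exact lt_of_le_of_ne (Real.arccos_le_pi t) (fun h => by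
        rw [Real.arccos_eq_pi] at h; linarith)
  rw [← him, lintegral_image_eq_lintegral_abs_deriv_mul measurableSet_Ioo
    (fun φ _ => (Real.hasDerivAt_cos φ).hasDerivWithinAt)
    (Real.injOn_cos.mono Ioo_subset_Icc_self)]
  refine setLIntegral_congr_fun measurableSet_Ioo fun φ hφ => ?_
  have hs := Real.sin_pos_of_pos_of_lt_pi hφ.1 hφ.2
  rw [← mul_assoc, ← ENNReal.ofReal_mul (by positivity), abs_neg, abs_of_pos hs]
  congr 2
  rw [show 1 - Real.cos φ^2 = Real.sin φ^2 by linarith [Real.sin_sq_add_cos_sq φ],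
    ← Real.rpow_natCast (Real.sin φ) 2, ← Real.rpow_mul hs.le]
  nth_rewrite 2 [← Real.rpow_one (Real.sin φ)]
  rw [← Real.rpow_add hs, ← Real.rpow_natCast]
  congr 1
  push_cast; ring

lemma aux_map (m : ℕ) (e : EuclideanSpace ℝ (Fin (m+2))) (he : ‖e‖ = 1) :
    ((volume : Measure (EuclideanSpace ℝ (Fin (m+2)))).toSphere).map
      (fun θ => inner ℝ e θ.1) =
    (volume.restrict (Ioo (-1:ℝ) 1)).withDensity (fun t => ENNReal.ofReal
      (2 * Real.pi ^ (((m+1 : ℕ) : ℝ) / 2) / Real.Gamma (((m+1 : ℕ) : ℝ) / 2)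
        * (1 - t^2) ^ (((m:ℝ) - 1)/2))) := by
  have hn : (0:ℝ) < ((m+1 : ℕ) : ℝ) / 2 := by positivity
  have hG := Real.Gamma_pos_of_pos hn
  refine Measure.ext_of_lintegral _ fun F hF => ?_
  rw [lintegral_map hF (by fun_prop), aux_slice m F hF e he, aux_slice', aux_sigma,
    lintegral_withDensity_eq_lintegral_mul _ (by fun_prop) hF,
    ← lintegral_const_mul _ (by fun_prop)]
  refine lintegral_congr fun t => ?_
  simp only [Pi.mul_apply]
  rw [ENNReal.ofReal_mul (by positivity), mul_assoc]

lemma aux_main (m : ℕ) (ρ : ℝ)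
    (hρ0 : 0 < ρ) (hρ1 : ρ < 1) (f₀ : ℝ → ℝ)
    (hf : IntegrableOn (fun s => f₀ s * (1 - s ^ 2) ^ (((m : ℝ) - 1) / 2) * s)
      (Set.Ioo |1 - 2 * ρ| 1) volume)
    (x : EuclideanSpace ℝ (Fin (m+2))) (hx : ‖x‖ = 1 - ρ) :
      ∫ θ : Metric.sphere (0 : EuclideanSpace ℝ (Fin (m+2))) 1,
        f₀ ‖x + ρ • (θ : EuclideanSpace ℝ (Fin (m+2)))‖
        ∂((volume : Measure (EuclideanSpace ℝ (Fin (m+2)))).toSphere) =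
    (2 * Real.pi ^ (((m+1 : ℕ) : ℝ) / 2) / Real.Gamma (((m+1 : ℕ) : ℝ) / 2)) *
      ∫ s in |1 - 2 * ρ|..1,
        f₀ s * (1 - s ^ 2) ^ (((m : ℝ) - 1) / 2) *
          (s ^ 2 - (1 - 2 * ρ) ^ 2) ^ (((m : ℝ) - 1) / 2) *
          (2 * ρ * (1 - ρ)) ^ (1 - (m : ℝ)) * (s / (ρ * (1 - ρ))) := by
  have hn : (0:ℝ) < ((m+1 : ℕ) : ℝ) / 2 := by positivity
  have hG := Real.Gamma_pos_of_pos hn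
  set σ : ℝ := 2 * Real.pi ^ (((m+1 : ℕ) : ℝ) / 2) / Real.Gamma (((m+1 : ℕ) : ℝ) / 2) with hσ
  have hσ0 : 0 < σ := by positivity
  set a : ℝ := ((m : ℝ) - 1) / 2 with ha
  have hr1 : 0 < 1 - ρ := by linarith
  set c : ℝ := ρ * (1 - ρ) with hc
  have hc0 : 0 < c := by positivity
  have habs : |1 - 2 * ρ| < 1 := abs_lt.2 ⟨by linarith, by linarith⟩
  set e : EuclideanSpace ℝ (Fin (m+2)) := (1 - ρ)⁻¹ • x with he
  have hxe : x = (1 - ρ) • e := by rw [he, smul_inv_smul₀ hr1.ne']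
  have hen : ‖e‖ = 1 := by
    rw [he, norm_smul, hx, norm_inv, Real.norm_eq_abs, abs_of_pos hr1, inv_mul_cancel₀ hr1.ne']
  set q : ℝ → ℝ := fun t => (1 - 2 * ρ)^2 + 2 * c * (1 + t) with hq
  have hq1 : ∀ t, 1 - q t = 2 * c * (1 - t) := by intro t; simp only [hq, hc]; ring
  set φ : ℝ → ℝ := fun t => √(q t) with hφ
  have hnorm : ∀ θ : Metric.sphere (0 : EuclideanSpace ℝ (Fin (m+2))) 1,
      ‖x + ρ • (θ : EuclideanSpace ℝ (Fin (m+2)))‖ = φ (inner ℝ e θ.1) := by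
    intro θ
    rw [hφ, ← Real.sqrt_sq (norm_nonneg _)]
    congr 1
    rw [norm_add_sq_real, hx, hxe, inner_smul_left, inner_smul_right, norm_smul,
      norm_eq_of_mem_sphere, Real.norm_eq_abs, abs_of_pos hρ0]
    simp [hq, hc]; ring
  have hqpos : ∀ t ∈ Ioo (-1:ℝ) 1, 0 < q t := by
    rintro t ⟨h1, h2⟩
    have : 0 < 2 * c * (1 + t) := mul_pos (by positivity) (by linarith)
    have := sq_nonneg (1 - 2 * ρ)
    simp only [hq]; linarith
  have hφpos : ∀ t ∈ Ioo (-1:ℝ) 1, 0 < φ t := fun t ht => Real.sqrt_pos.2 (hqpos t ht)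
  have hφsq : ∀ t ∈ Ioo (-1:ℝ) 1, φ t ^ 2 = q t := fun t ht => Real.sq_sqrt (hqpos t ht).le
  have hderiv : ∀ t ∈ Ioo (-1:ℝ) 1, HasDerivWithinAt φ (c / φ t) (Ioo (-1:ℝ) 1) t := by
    intro t ht
    have h1 : HasDerivAt q (2 * c) t := by
      have := (((hasDerivAt_id' t).const_add 1).const_mul (2 * c)).const_add ((1 - 2 * ρ)^2)
      rw [mul_one] at this
      exact this
    have h2 := h1.sqrt (hqpos t ht).ne'
    have h3 : c / φ t = 2 * c / (2 * φ t) := (mul_div_mul_left c (φ t) two_ne_zero).symm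
    rw [h3]
    exact h2.hasDerivWithinAt
  have hinj : InjOn φ (Ioo (-1:ℝ) 1) := by
    intro s hs t ht hst
    have h1 := hφsq s hs
    rw [hst, hφsq t ht] at h1
    simp only [hq] at h1
    have : 2 * c * (t - s) = 0 := by linarith
    rcases mul_eq_zero.1 this with h | h
    · linarith
    · linarith
  have him : φ '' Ioo (-1:ℝ) 1 = Ioo |1 - 2 * ρ| 1 := by
    ext s
    constructor
    · rintro ⟨t, ht, rfl⟩
      have h1 := hφsq t ht
      have h2 := hφpos t ht
      have h3 := hq1 t
      have h4 : 0 < 2 * c * (1 - t) := mul_pos (by positivity) (by linarith [ht.2])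
      have h5 : 0 < 2 * c * (1 + t) := mul_pos (by positivity) (by linarith [ht.1])
      constructor
      · apply lt_of_pow_lt_pow_left₀ 2 h2.le
        rw [sq_abs, h1]; simp only [hq]; linarith
      · apply lt_of_pow_lt_pow_left₀ 2 zero_le_one
        rw [h1]; linarith
    · rintro ⟨h1, h2⟩
      have hs0 : 0 < s := lt_of_le_of_lt (abs_nonneg _) h1
      have h3 : (1 - 2 * ρ)^2 < s^2 := by
        rw [← sq_abs (1 - 2 * ρ)]; exact pow_lt_pow_left₀ h1 (abs_nonneg _) two_ne_zero
      have h4 : s^2 < 1 := by nlinarith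
      have h5 : q ((s^2 - (1 - 2 * ρ)^2) / (2 * c) - 1) = s^2 := by
        simp only [hq]; field_simp; ring
      refine ⟨(s^2 - (1 - 2 * ρ)^2) / (2 * c) - 1, ⟨?_, ?_⟩, ?_⟩
      · have : 0 < (s^2 - (1 - 2 * ρ)^2) / (2 * c) := div_pos (by linarith) (by positivity)
        linarith
      · rw [sub_lt_iff_lt_add, div_lt_iff₀ (by positivity)]
        simp only [hc]; nlinarith
      · rw [hφ]; simp only; rw [h5, Real.sqrt_sq hs0.le]
  have hmeas : AEStronglyMeasurable (fun t => f₀ (φ t)) (volume.restrict (Ioo (-1:ℝ) 1)) := by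
    rw [← him, integrableOn_image_iff_integrableOn_abs_deriv_smul measurableSet_Ioo hderiv hinj] at hf
    have h1 := hf.aestronglyMeasurable
    have h2 : AEStronglyMeasurable (fun t : ℝ => ((2 * c * (1 - t)) ^ a * c)⁻¹)
      (volume.restrict (Ioo (-1:ℝ) 1)) := by
      apply Measurable.aestronglyMeasurable; fun_prop
    refine (h1.mul h2).congr ?_
    filter_upwards [ae_restrict_mem measurableSet_Ioo] with t ht
    have h3 := hφpos t ht
    have h4 : 0 < 2 * c * (1 - t) := mul_pos (by positivity) (by linarith [ht.2])
    have h5 : 0 < (2 * c * (1 - t)) ^ a := Real.rpow_pos_of_pos h4 _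
    simp only [Pi.mul_apply, smul_eq_mul]
    rw [hφsq t ht, hq1, abs_of_pos (div_pos hc0 h3)]
    generalize (2 * c * (1 - t)) ^ a = w at h5
    field_simp
  simp_rw [hnorm]
  have hmap := aux_map m e hen
  have hdm : Measurable (fun t : ℝ => (σ * (1 - t^2) ^ a).toNNReal) := by fun_prop
  have hI : ∫ θ : Metric.sphere (0 : EuclideanSpace ℝ (Fin (m+2))) 1, f₀ (φ (inner ℝ e θ.1))
        ∂((volume : Measure (EuclideanSpace ℝ (Fin (m+2)))).toSphere) =
      ∫ t in Ioo (-1:ℝ) 1, (σ * (1 - t^2) ^ a).toNNReal • f₀ (φ t) := by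
    rw [← integral_withDensity_eq_integral_smul hdm]
    change _ = ∫ t, f₀ (φ t) ∂(volume.restrict (Ioo (-1:ℝ) 1)).withDensity (fun t => ENNReal.ofReal (σ * (1 - t^2) ^ a))
    rw [← hmap, integral_map (f := fun t => f₀ (φ t)) (by fun_prop)]
    rw [hmap]
    exact hmeas.mono_ac (withDensity_absolutelyContinuous _ _)
  rw [hI, intervalIntegral.integral_of_le habs.le, integral_Ioc_eq_integral_Ioo, ← him,
    integral_image_eq_integral_abs_deriv_smul measurableSet_Ioo hderiv hinj, ← integral_const_mul]
  refine setIntegral_congr_fun measurableSet_Ioo fun t ht => ?_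
  have h3 := hφpos t ht
  have hm1 : 0 < 1 - t := by linarith [ht.2]
  have hp1 : 0 < 1 + t := by linarith [ht.1]
  have h6 : 0 < 2 * c := by positivity
  simp only [NNReal.smul_def, smul_eq_mul]
  have h7 : 1 - t^2 = (1 - t) * (1 + t) := by ring
  rw [hφsq t ht, hq1, abs_of_pos (div_pos hc0 h3), h7,
    show q t - (1 - 2 * ρ)^2 = 2 * c * (1 + t) by simp only [hq]; ring,
    Real.coe_toNNReal _ (by positivity), Real.mul_rpow hm1.le hp1.le, Real.mul_rpow h6.le hm1.le,
    Real.mul_rpow h6.le hp1.le, show 2 * ρ * (1 - ρ) = 2 * c by rw [hc]; ring]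
  have h8 : (2 * c) ^ a * (2 * c) ^ a * (2 * c) ^ (1 - (m:ℝ)) = 1 := by
    rw [← Real.rpow_add h6, ← Real.rpow_add h6, show a + a + (1 - (m:ℝ)) = 0 by rw [ha]; ring,
      Real.rpow_zero]
  have h9 : c / φ t * (φ t / c) = 1 := by field_simp
  calc σ * ((1 - t) ^ a * (1 + t) ^ a) * f₀ (φ t)
      = σ * ((1 - t) ^ a * (1 + t) ^ a) * f₀ (φ t) * ((2 * c) ^ a * (2 * c) ^ a * (2 * c) ^ (1 - (m:ℝ)))
        * (c / φ t * (φ t / c)) := by rw [h8, h9]; ring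
    _ = _ := by ring

/-- Interior tangent spherical mean of a radial function as a one-dimensional
Abel-type integral (Lemma 3.2). -/
theorem interior_tangent_spherical_mean (k : ℕ) (hk : 2 ≤ k) (ρ : ℝ)
    (hρ0 : 0 < ρ) (hρ1 : ρ < 1) (f₀ : ℝ → ℝ)
    (hf : IntegrableOn (fun s => f₀ s * (1 - s ^ 2) ^ (((k : ℝ) - 3) / 2) * s)
      (Set.Ioo |1 - 2 * ρ| 1) volume)
    (x : EuclideanSpace ℝ (Fin k)) (hx : ‖x‖ = 1 - ρ) :
    (2 * Real.pi ^ ((k : ℝ) / 2) / Real.Gamma ((k : ℝ) / 2))⁻¹ *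
      ∫ θ : Metric.sphere (0 : EuclideanSpace ℝ (Fin k)) 1,
        f₀ ‖x + ρ • (θ : EuclideanSpace ℝ (Fin k))‖
        ∂((volume : Measure (EuclideanSpace ℝ (Fin k))).toSphere) =
    ((2 * Real.pi ^ (((k : ℝ) - 1) / 2) / Real.Gamma (((k : ℝ) - 1) / 2)) /
        (2 * Real.pi ^ ((k : ℝ) / 2) / Real.Gamma ((k : ℝ) / 2))) *
      ∫ s in |1 - 2 * ρ|..1,
        f₀ s * (1 - s ^ 2) ^ (((k : ℝ) - 3) / 2) *
          (s ^ 2 - (1 - 2 * ρ) ^ 2) ^ (((k : ℝ) - 3) / 2) *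
          (2 * ρ * (1 - ρ)) ^ (3 - (k : ℝ)) * (s / (ρ * (1 - ρ))) := by
  obtain ⟨m, rfl⟩ : ∃ m, k = m + 2 := ⟨k - 2, by omega⟩
  have e1 : ((m + 2 : ℕ) : ℝ) - 3 = (m : ℝ) - 1 := by push_cast; ring
  have e2 : (3 : ℝ) - ((m + 2 : ℕ) : ℝ) = 1 - (m : ℝ) := by push_cast; ring
  have e3 : ((m + 2 : ℕ) : ℝ) - 1 = ((m + 1 : ℕ) : ℝ) := by push_cast; ring
  rw [e1] at hf
  rw [e1, e2, e3, aux_main m ρ hρ0 hρ1 f₀ hf x hx, ← mul_assoc]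
  congr 1
  exact (div_eq_inv_mul _ _).symm
end

section
/- (Support theorem, radial interior case.) Let 2 ≤ k ≤ n, f₀ : (0,1) → ℝ with ∫_ε^1 |f₀(s)|(1-s²)^{(k-3)/2} s ds < ∞ for every ε ∈ (0,1), and let 0 < δ < 1. If F₊(t) = ∫_t^1 (s²-t²)^{(k-3)/2} f₀(s)(1-s²)^{(k-3)/2} s ds = 0 for all t ∈ (δ, 1), then f₀(s) = 0 for almost all s ∈ (δ, 1). -/
open MeasureTheory Set

lemma its_fubini (τ : ℝ) (g : ℝ → ℝ) (hg : IntegrableOn g (Ioo τ 1))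
    (K : ℝ → ℝ → ℝ) (hK : Measurable (Function.uncurry K))
    (hK0 : ∀ s t, τ < t → t < s → s < 1 → 0 ≤ K s t) (c : ℝ → ℝ)
    (hint : ∀ s ∈ Ioo τ 1, IntegrableOn (K s) (Ioo τ s))
    (hc : ∀ s ∈ Ioo τ 1, ∫ t in Ioo τ s, K s t = c s)
    (hcg : IntegrableOn (fun s => c s * g s) (Ioo τ 1)) :
    ∫ t in Ioo τ 1, (∫ s in Ioo t 1, K s t * g s) = ∫ s in Ioo τ 1, c s * g s := by
  set μ : Measure ℝ := volume.restrict (Ioo τ 1) with hμ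
  let Φ : ℝ → ℝ → ℝ := fun s t => (Iio s).indicator (K s) t * g s
  have hset : MeasurableSet {p : ℝ × ℝ | p.2 < p.1} :=
    measurableSet_lt measurable_snd measurable_fst
  have hmeas : AEStronglyMeasurable (Function.uncurry Φ) (μ.prod μ) := by
    have h1 : Measurable (fun p : ℝ × ℝ => (Iio p.1).indicator (K p.1) p.2) := by
      have : (fun p : ℝ × ℝ => (Iio p.1).indicator (K p.1) p.2)
          = {p : ℝ × ℝ | p.2 < p.1}.indicator (Function.uncurry K) := by
        ext p
        simp [indicator, Function.uncurry]
      rw [this]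
      exact hK.indicator hset
    exact h1.aestronglyMeasurable.mul hg.aestronglyMeasurable.comp_fst
  have hinter : ∀ s ∈ Ioo τ 1, Ioo τ 1 ∩ Iio s = Ioo τ s := by
    intro s hs
    ext x
    simp only [mem_inter_iff, mem_Ioo, mem_Iio] at *
    constructor
    · rintro ⟨⟨a, b⟩, d⟩; exact ⟨a, d⟩
    · rintro ⟨a, b⟩; exact ⟨⟨a, b.trans hs.2⟩, b⟩
  have hKi : ∀ s ∈ Ioo τ 1, Integrable ((Iio s).indicator (K s)) μ := by
    intro s hs
    rw [integrable_indicator_iff measurableSet_Iio, IntegrableOn, hμ,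
      Measure.restrict_restrict measurableSet_Iio, inter_comm, hinter s hs]
    exact hint s hs
  have hKc : ∀ s ∈ Ioo τ 1, ∫ t, (Iio s).indicator (K s) t ∂μ = c s := by
    intro s hs
    rw [integral_indicator measurableSet_Iio, hμ,
      Measure.restrict_restrict measurableSet_Iio, inter_comm, hinter s hs]
    exact hc s hs
  have hnorm : ∀ s ∈ Ioo τ 1, ∫ t, ‖Φ s t‖ ∂μ = ‖c s * g s‖ := by
    intro s hs
    have h0 : 0 ≤ c s := by
      rw [← hc s hs]
      exact setIntegral_nonneg measurableSet_Ioo (fun t ht => hK0 s t ht.1 ht.2 hs.2)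
    rw [norm_mul, Real.norm_of_nonneg h0, ← hKc s hs, ← integral_mul_const]
    refine setIntegral_congr_fun measurableSet_Ioo (fun t ht => ?_)
    simp only [Φ, norm_mul]
    congr 1
    refine Real.norm_of_nonneg ?_
    by_cases h : t < s
    · rw [indicator_of_mem (by exact h)]; exact hK0 s t ht.1 h hs.2
    · rw [indicator_of_notMem (by exact h)]
  have hI : Integrable (Function.uncurry Φ) (μ.prod μ) := by
    rw [integrable_prod_iff hmeas]
    constructor
    · filter_upwards [ae_restrict_mem measurableSet_Ioo] with s hs
      exact (hKi s hs).mul_const (g s)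
    · refine (hcg.norm).congr ?_
      filter_upwards [ae_restrict_mem measurableSet_Ioo] with s hs
      exact (hnorm s hs).symm
  have hsw := integral_integral_swap hI
  have hl : ∫ s, ∫ t, Φ s t ∂μ ∂μ = ∫ s in Ioo τ 1, c s * g s := by
    refine setIntegral_congr_fun measurableSet_Ioo (fun s hs => ?_)
    simp only [Φ]
    rw [integral_mul_const, hKc s hs]
  have hr : ∫ t, ∫ s, Φ s t ∂μ ∂μ = ∫ t in Ioo τ 1, (∫ s in Ioo t 1, K s t * g s) := by
    refine setIntegral_congr_fun measurableSet_Ioo (fun t ht => ?_)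
    have : (fun s => Φ s t) = (Ioi t).indicator (fun s => K s t * g s) := by
      ext s
      simp only [Φ, indicator, mem_Iio, mem_Ioi]
      split_ifs <;> simp
    have hin : Ioi t ∩ Ioo τ 1 = Ioo t 1 := by
      ext x
      simp only [mem_inter_iff, mem_Ioo, mem_Ioi] at *
      constructor
      · rintro ⟨a, b, d⟩; exact ⟨a, d⟩
      · rintro ⟨a, b⟩; exact ⟨a, ht.1.trans a, b⟩
    simp only [this]
    rw [integral_indicator measurableSet_Ioi, hμ,
      Measure.restrict_restrict measurableSet_Ioi, hin]
  rw [← hr, ← hl, hsw]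

lemma its_base (δ : ℝ) (g : ℝ → ℝ) (hg : IntegrableOn g (Ioo δ 1)) (hδ1 : δ < 1)
    (h : ∀ τ ∈ Ioo δ 1, ∫ s in Ioo τ 1, g s = 0) :
    ∀ᵐ s ∂(volume.restrict (Ioo δ 1)), g s = 0 := by
  have hi : IntervalIntegrable g volume δ 1 := by
    rw [intervalIntegrable_iff_integrableOn_Ioo_of_le hδ1.le]; exact hg
  rw [ae_restrict_iff' measurableSet_Ioo]
  filter_upwards [hi.ae_hasDerivAt_integral] with x hx hxm
  have h1 := hx (by rw [uIcc_of_le hδ1.le]; exact Ioo_subset_Icc_self hxm) 1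
    (by rw [uIcc_of_le hδ1.le]; exact ⟨hδ1.le, le_rfl⟩)
  have h2 : (fun x => ∫ t in (1:ℝ)..x, g t) =ᶠ[nhds x] fun _ => 0 := by
    filter_upwards [Ioo_mem_nhds hxm.1 hxm.2] with y hy
    rw [intervalIntegral.integral_symm, intervalIntegral.integral_of_le hy.2.le,
      integral_Ioc_eq_integral_Ioo, h y hy, neg_zero]
  exact (h1.unique ((hasDerivAt_const x (0:ℝ)).congr_of_eventuallyEq h2))

lemma its_int (δ : ℝ) (hδ0 : 0 < δ) (hδ1 : δ < 1) (m : ℕ) :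
    ∀ g : ℝ → ℝ, IntegrableOn g (Ioo δ 1) →
    (∀ τ ∈ Ioo δ 1, ∫ s in Ioo τ 1, (s ^ 2 - τ ^ 2) ^ m * g s = 0) →
    ∀ᵐ s ∂(volume.restrict (Ioo δ 1)), g s = 0 := by
  induction m with
  | zero =>
    intro g hg h
    exact its_base δ g hg hδ1 (by simpa using h)
  | succ m ih =>
    intro g hg h
    let g' : ℝ → ℝ := (Ioo δ 1).indicator g
    have hg' : Integrable g' := (integrable_indicator_iff measurableSet_Ioo).2 hg
    let G : ℝ → ℝ := fun t => - ∫ s in (1:ℝ)..t, g' s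
    have hGc : Continuous G :=
      (intervalIntegral.continuous_primitive (fun a b => hg'.intervalIntegrable) 1).neg
    have hG : ∀ t ∈ Ioo δ 1, G t = ∫ s in Ioo t 1, g s := by
      intro t ht
      simp only [G]
      rw [intervalIntegral.integral_symm, neg_neg, intervalIntegral.integral_of_le ht.2.le,
        integral_Ioc_eq_integral_Ioo]
      refine setIntegral_congr_fun measurableSet_Ioo (fun s hs => ?_)
      exact indicator_of_mem (show s ∈ Ioo δ 1 from ⟨ht.1.trans hs.1, hs.2⟩) g
    have key := ih (fun t => 2 * (m + 1) * t * G t)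
      ((by fun_prop : Continuous fun t => 2 * ((m:ℝ) + 1) * t * G t).integrableOn_Icc.mono_set
        Ioo_subset_Icc_self) (by
        intro τ hτ
        have hsub : Ioo τ 1 ⊆ Ioo δ 1 := Ioo_subset_Ioo_left hτ.1.le
        have hf := its_fubini τ g (hg.mono_set hsub)
          (fun s t => 2 * (m + 1) * t * (t ^ 2 - τ ^ 2) ^ m)
          (by unfold Function.uncurry; fun_prop)
          (by
            intro s t h1 h2 h3
            have h4 : 0 < τ := hδ0.trans hτ.1
            have h5 : 0 ≤ t ^ 2 - τ ^ 2 := by nlinarith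
            have h6 : 0 < t := h4.trans h1
            positivity)
          (fun s => (s ^ 2 - τ ^ 2) ^ (m + 1))
          (by
            intro s hs
            exact (by fun_prop : Continuous fun t : ℝ =>
              2 * ((m:ℝ) + 1) * t * (t ^ 2 - τ ^ 2) ^ m).integrableOn_Icc.mono_set
              Ioo_subset_Icc_self)
          (by
            intro s hs
            rw [← integral_Ioc_eq_integral_Ioo, ← intervalIntegral.integral_of_le hs.1.le]
            rw [intervalIntegral.integral_eq_sub_of_hasDerivAt
              (f := fun t : ℝ => (t ^ 2 - τ ^ 2) ^ (m + 1))]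
            · simp
            · intro x _
              have := (((hasDerivAt_id x).pow 2).sub_const (τ ^ 2)).pow (m + 1)
              convert! this using 1
              simp
              ring
            · exact (by fun_prop : Continuous fun t : ℝ =>
                2 * ((m:ℝ) + 1) * t * (t ^ 2 - τ ^ 2) ^ m).intervalIntegrable _ _)
          (by
            have : IntegrableOn g (Ioo τ 1) := hg.mono_set hsub
            refine Integrable.bdd_mul (c := 1) this
              (by fun_prop : Continuous fun s : ℝ => (s ^ 2 - τ ^ 2) ^ (m + 1)).aestronglyMeasurable
              ?_
            filter_upwards [ae_restrict_mem measurableSet_Ioo] with s hs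
            have h4 : 0 < τ := hδ0.trans hτ.1
            have h5 : 0 ≤ s ^ 2 - τ ^ 2 := by nlinarith [hs.1]
            have h6 : s ^ 2 - τ ^ 2 ≤ 1 := by nlinarith [hs.1, hs.2]
            rw [Real.norm_of_nonneg (by positivity)]
            exact pow_le_one₀ h5 h6)
        rw [h τ hτ] at hf
        rw [← hf]
        refine setIntegral_congr_fun measurableSet_Ioo (fun t ht => ?_)
        rw [hG t (hsub ht), integral_const_mul]
        ring)
    have hG0 : G =ᵐ[volume.restrict (Ioo δ 1)] fun _ => 0 := by
      filter_upwards [key, ae_restrict_mem measurableSet_Ioo] with t ht htm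
      have h6 : 0 < t := hδ0.trans htm.1
      have : 2 * ((m:ℝ) + 1) * t ≠ 0 := by positivity
      exact (mul_eq_zero.1 ht).resolve_left this
    have hG1 := Measure.eqOn_open_of_ae_eq hG0 isOpen_Ioo hGc.continuousOn continuousOn_const
    exact its_base δ g hg hδ1 (fun τ hτ => by rw [← hG τ hτ]; exact hG1 hτ)

lemma its_beta (α : ℝ) (hα : -1 < α) :
    IntegrableOn (fun x : ℝ => x ^ α * (1 - x) ^ α) (Ioo 0 1) ∧
    0 < ∫ x in Ioo (0:ℝ) 1, x ^ α * (1 - x) ^ α := by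
  have h := Complex.betaIntegral_convergent (u := ((α + 1 : ℝ) : ℂ)) (v := ((α + 1 : ℝ) : ℂ))
    (by rw [Complex.ofReal_re]; linarith) (by rw [Complex.ofReal_re]; linarith)
  have h1 := h.norm
  rw [intervalIntegrable_iff_integrableOn_Ioo_of_le zero_le_one] at h1
  have h2 : IntegrableOn (fun x : ℝ => x ^ α * (1 - x) ^ α) (Ioo 0 1) := by
    refine h1.congr_fun (fun x hx => ?_) measurableSet_Ioo
    simp only [norm_mul]
    have e : ((α + 1 : ℝ) : ℂ) - 1 = (α : ℂ) := by push_cast; ring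
    have e2 : (1 : ℂ) - x = ((1 - x : ℝ) : ℂ) := by push_cast; ring
    rw [e, e2, Complex.norm_cpow_eq_rpow_re_of_pos hx.1,
      Complex.norm_cpow_eq_rpow_re_of_pos (by linarith [hx.2]), Complex.ofReal_re]
  refine ⟨h2, ?_⟩
  rw [← integral_Ioc_eq_integral_Ioo, ← intervalIntegral.integral_of_le zero_le_one]
  refine intervalIntegral.intervalIntegral_pos_of_pos_on ?_ ?_ zero_lt_one
  · rw [intervalIntegrable_iff_integrableOn_Ioo_of_le zero_le_one]; exact h2
  · intro x hx
    exact mul_pos (Real.rpow_pos_of_pos hx.1 _) (Real.rpow_pos_of_pos (by linarith [hx.2]) _)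

lemma its_kernel (k : ℕ) (hk : 2 ≤ k) (τ s : ℝ) (hτ : 0 < τ) (hs : τ < s) :
    IntegrableOn (fun t : ℝ => (s ^ 2 - t ^ 2) ^ (((k : ℝ) - 3) / 2) *
      (t ^ 2 - τ ^ 2) ^ (((k : ℝ) - 3) / 2) * t) (Ioo τ s) ∧
    ∫ t in Ioo τ s, (s ^ 2 - t ^ 2) ^ (((k : ℝ) - 3) / 2) *
      (t ^ 2 - τ ^ 2) ^ (((k : ℝ) - 3) / 2) * t =
    ((∫ x in Ioo (0:ℝ) 1, x ^ (((k : ℝ) - 3) / 2) * (1 - x) ^ (((k : ℝ) - 3) / 2)) / 2)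
      * (s ^ 2 - τ ^ 2) ^ (k - 2) := by
  set α : ℝ := ((k : ℝ) - 3) / 2 with hαd
  have hk' : (2:ℝ) ≤ k := by exact_mod_cast hk
  have hα : -1 < α := by rw [hαd]; linarith
  set D : ℝ := s ^ 2 - τ ^ 2 with hD
  have hDp : 0 < D := by rw [hD]; nlinarith
  let φ : ℝ → ℝ := fun t => (t ^ 2 - τ ^ 2) / D
  have hder : ∀ t ∈ Ioo τ s, HasDerivWithinAt φ (2 * t / D) (Ioo τ s) t := by
    intro t _
    have := ((((hasDerivAt_id t).pow 2).sub_const (τ ^ 2)).div_const D)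
    refine HasDerivAt.hasDerivWithinAt ?_
    convert! this using 1
    simp
  have hinj : InjOn φ (Ioo τ s) := by
    intro a ha b hb hab
    simp only [φ] at hab
    have h1 : a ^ 2 - τ ^ 2 = b ^ 2 - τ ^ 2 := by
      field_simp at hab; exact hab
    have h2 : (a - b) * (a + b) = 0 := by linarith
    rcases mul_eq_zero.1 h2 with h | h
    · linarith
    · linarith [ha.1, hb.1]
  have himg : φ '' (Ioo τ s) = Ioo 0 1 := by
    ext x
    constructor
    · rintro ⟨t, ht, rfl⟩
      refine ⟨div_pos (by nlinarith [ht.1]) hDp, ?_⟩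
      simp only [φ]
      rw [div_lt_one hDp, hD]
      nlinarith [ht.1, ht.2]
    · intro hx
      have hp : 0 < x * D := mul_pos hx.1 hDp
      have hp2 : x * D < D := by nlinarith [hx.2]
      refine ⟨Real.sqrt (x * D + τ ^ 2), ⟨?_, ?_⟩, ?_⟩
      · exact Real.lt_sqrt_of_sq_lt (by linarith)
      · rw [Real.sqrt_lt' (hτ.trans hs)]; linarith
      · simp only [φ]
        rw [Real.sq_sqrt (by positivity)]
        field_simp
        ring
  have hpow : ∀ t ∈ Ioo τ s, (D ^ (k - 2) / 2) *
      (|2 * t / D| • (φ t ^ α * (1 - φ t) ^ α)) = (s ^ 2 - t ^ 2) ^ α * (t ^ 2 - τ ^ 2) ^ α * t := by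
    intro t ht
    have ht0 : 0 < t := hτ.trans ht.1
    have p1 : 0 ≤ t ^ 2 - τ ^ 2 := by nlinarith [ht.1]
    have p2 : 0 ≤ s ^ 2 - t ^ 2 := by nlinarith [ht.2]
    have e1 : 1 - φ t = (s ^ 2 - t ^ 2) / D := by
      simp only [φ]; field_simp; rw [hD]; ring
    rw [e1, abs_of_pos (by positivity), smul_eq_mul]
    simp only [φ]
    rw [Real.div_rpow p1 hDp.le, Real.div_rpow p2 hDp.le]
    have hq : D ^ (k - 2) = D ^ α * D ^ α * D := by
      rw [← Real.rpow_natCast, ← Real.rpow_add hDp]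
      nth_rewrite 3 [← Real.rpow_one D]
      rw [← Real.rpow_add hDp]
      congr 1
      rw [Nat.cast_sub hk, hαd]
      push_cast
      ring
    have hDa : 0 < D ^ α := Real.rpow_pos_of_pos hDp _
    rw [hq]
    field_simp
  obtain ⟨hb, _⟩ := its_beta α hα
  constructor
  · rw [← himg, integrableOn_image_iff_integrableOn_abs_deriv_smul measurableSet_Ioo hder hinj] at hb
    exact IntegrableOn.congr_fun (hb.const_mul (D ^ (k - 2) / 2)) hpow measurableSet_Ioo
  · rw [← setIntegral_congr_fun measurableSet_Ioo hpow, integral_const_mul,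
      ← integral_image_eq_integral_abs_deriv_smul measurableSet_Ioo hder hinj
        (fun x => x ^ α * (1 - x) ^ α), himg]
    ring

/-- Theorem 3.7 (support theorem, radial interior case): if the Abel-type transform
`F₊` of a radial function vanishes on `(δ, 1)`, then `f₀ = 0` a.e. on `(δ, 1)`. -/
theorem interior_tangent_support (n k : ℕ) (hk : 2 ≤ k) (hkn : k ≤ n)
    (f₀ : ℝ → ℝ)
    (hf : ∀ ε ∈ Set.Ioo (0:ℝ) 1,
      IntegrableOn (fun s => f₀ s * (1 - s ^ 2) ^ (((k : ℝ) - 3) / 2) * s)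
        (Set.Ioo ε 1) volume)
    (δ : ℝ) (hδ0 : 0 < δ) (hδ1 : δ < 1)
    (hF : ∀ t ∈ Set.Ioo δ 1,
      (∫ s in t..1, (s ^ 2 - t ^ 2) ^ (((k : ℝ) - 3) / 2) *
        (f₀ s * (1 - s ^ 2) ^ (((k : ℝ) - 3) / 2) * s)) = 0) :
    ∀ᵐ s ∂(volume.restrict (Set.Ioo δ 1)), f₀ s = 0 := by
  have hg := hf δ ⟨hδ0, hδ1⟩
  set g : ℝ → ℝ := fun s => f₀ s * (1 - s ^ 2) ^ (((k : ℝ) - 3) / 2) * s with hgd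
  have hk' : (2:ℝ) ≤ k := by exact_mod_cast hk
  have hCpos := (its_beta (((k : ℝ) - 3) / 2) (by linarith)).2
  have hg0 : ∀ᵐ s ∂(volume.restrict (Ioo δ 1)), g s = 0 := by
    refine its_int δ hδ0 hδ1 (k - 2) g hg (fun τ hτ => ?_)
    have hτ0 : 0 < τ := hδ0.trans hτ.1
    have hsub : Ioo τ 1 ⊆ Ioo δ 1 := Ioo_subset_Ioo_left hτ.1.le
    have hfub := its_fubini τ g (hg.mono_set hsub)
      (fun s t => (s ^ 2 - t ^ 2) ^ (((k : ℝ) - 3) / 2) *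
        (t ^ 2 - τ ^ 2) ^ (((k : ℝ) - 3) / 2) * t)
      (by unfold Function.uncurry; fun_prop)
      (by
        intro s t h1 h2 h3
        have h5 : 0 ≤ t ^ 2 - τ ^ 2 := by nlinarith
        have h6 : 0 < t := hτ0.trans h1
        have h7 : 0 ≤ s ^ 2 - t ^ 2 := by nlinarith
        positivity)
      _ (fun s hs => (its_kernel k hk τ s hτ0 hs.1).1)
      (fun s hs => (its_kernel k hk τ s hτ0 hs.1).2)
      (by
        simp only [mul_assoc]
        refine Integrable.const_mul ?_ _
        refine Integrable.bdd_mul (c := 1) (hg.mono_set hsub)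
          (by fun_prop : Continuous fun s : ℝ => (s ^ 2 - τ ^ 2) ^ (k - 2)).aestronglyMeasurable
          ?_
        filter_upwards [ae_restrict_mem measurableSet_Ioo] with s hs
        have h5 : 0 ≤ s ^ 2 - τ ^ 2 := by nlinarith [hs.1]
        have h6 : s ^ 2 - τ ^ 2 ≤ 1 := by nlinarith [hs.1, hs.2]
        rw [Real.norm_of_nonneg (by positivity)]
        exact pow_le_one₀ h5 h6)
    have hz : ∫ t in Ioo τ 1, (∫ s in Ioo t 1, (s ^ 2 - t ^ 2) ^ (((k : ℝ) - 3) / 2) *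
        (t ^ 2 - τ ^ 2) ^ (((k : ℝ) - 3) / 2) * t * g s) = 0 := by
      refine setIntegral_eq_zero_of_forall_eq_zero (fun t ht => ?_)
      have h1 := hF t (hsub ht)
      rw [intervalIntegral.integral_of_le ht.2.le, integral_Ioc_eq_integral_Ioo] at h1
      have h2 : ∀ s : ℝ, (s ^ 2 - t ^ 2) ^ (((k : ℝ) - 3) / 2) *
        (t ^ 2 - τ ^ 2) ^ (((k : ℝ) - 3) / 2) * t * g s =
        ((t ^ 2 - τ ^ 2) ^ (((k : ℝ) - 3) / 2) * t) *
          ((s ^ 2 - t ^ 2) ^ (((k : ℝ) - 3) / 2) * g s) := fun s => by ring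
      simp only [h2]
      rw [integral_const_mul]
      exact mul_eq_zero_of_right _ h1
    rw [hz] at hfub
    simp only [mul_assoc] at hfub
    rw [integral_const_mul] at hfub
    exact (mul_eq_zero.1 hfub.symm).resolve_left (by positivity)
  filter_upwards [hg0, ae_restrict_mem measurableSet_Ioo] with s hs hsm
  have hs0 : 0 < s := hδ0.trans hsm.1
  have hw : 0 < (1 - s ^ 2) ^ (((k : ℝ) - 3) / 2) :=
    Real.rpow_pos_of_pos (by nlinarith [hsm.2]) _
  simp only [hgd] at hs
  rcases mul_eq_zero.1 hs with h | h
  · exact (mul_eq_zero.1 h).resolve_right hw.ne'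
  · exact absurd h hs0.ne'
end
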